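/- arXiv:1605.08581 — 2 statements merged into one kernel-verified Lean document; each statement's English description precedes it below -/
import Mathlib

section
/- Let φ, φ₁ be Young functions and let 0 < a ≤ b_{φ₁} = sup{t≥0 : φ₁(t)<∞}. Then the function φ⊖_a φ₁ defined by φ⊖_a φ₁(u) = sup_{0≤s≤a}{φ(su) − φ₁(s)} is itself a Young function, i.e. it is convex, non-decreasing, and vanishes at 0. -/
open MeasureTheory ENNReal NNReal Filter Topology

/-- A Young function: a convex, non-decreasing function `φ : [0,∞) → [0,∞]`
with `φ 0 = 0`, not identically zero (the value `∞` is allowed). -/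
structure YoungFunction where
  toFun : ℝ≥0 → ℝ≥0∞
  map_zero' : toFun 0 = 0
  mono' : Monotone toFun
  convex' : ∀ s t a b : ℝ≥0, a + b = 1 →
    toFun (a * s + b * t) ≤ (a : ℝ≥0∞) * toFun s + (b : ℝ≥0∞) * toFun t
  ne_zero' : ∃ u : ℝ≥0, toFun u ≠ 0

/-- `b_f = sup {t ≥ 0 : f t < ∞}`, as an extended nonnegative real. -/
noncomputable def bSup (f : ℝ≥0 → ℝ≥0∞) : ℝ≥0∞ :=
  ⨆ (t : ℝ≥0) (_ : f t < ∞), (t : ℝ≥0∞)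

/-- The conjugate function of `f₁` with respect to `f`:
`f ⊖ f₁ (u) = sup_{s > 0} (f (s·u) - f₁ s)`.  The truncated subtraction of `ℝ≥0∞`
(in which `a - b = 0` whenever `b = ∞`) implements exactly the convention that the
supremum is restricted to `0 < s < b_{f₁}` when `f₁ b_{f₁} = ∞` and to
`0 < s ≤ b_{f₁}` when `f₁ b_{f₁} < ∞`. -/
noncomputable def ominus (f f₁ : ℝ≥0 → ℝ≥0∞) (u : ℝ≥0) : ℝ≥0∞ :=
  ⨆ s : ℝ≥0, (f (s * u) - f₁ s)

/-- The truncated conjugate function `f ⊖_a f₁ (u) = sup_{0 ≤ s ≤ a} (f (s·u) - f₁ s)`. -/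
noncomputable def ominusTrunc (f f₁ : ℝ≥0 → ℝ≥0∞) (a : ℝ≥0) (u : ℝ≥0) : ℝ≥0∞ :=
  ⨆ s ∈ Set.Icc (0 : ℝ≥0) a, (f (s * u) - f₁ s)

/-- The right-continuous inverse `f⁻¹ (v) = inf {u ≥ 0 : f u > v}`. -/
noncomputable def rcInv (f : ℝ≥0 → ℝ≥0∞) (v : ℝ≥0∞) : ℝ≥0∞ :=
  ⨅ (u : ℝ≥0) (_ : v < f u), (u : ℝ≥0∞)

variable {Ω : Type*} [MeasurableSpace Ω]

/-- The Orlicz modular `I_f(x) = ∫_Ω f |x| dμ`. -/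
noncomputable def orliczModular (f : ℝ≥0 → ℝ≥0∞) (μ : Measure Ω) (x : Ω → ℝ) : ℝ≥0∞ :=
  ∫⁻ t, f ‖x t‖₊ ∂μ

/-- Membership in the Orlicz space `L^f`: `x` is (a.e.) measurable and
`I_f(λ x) < ∞` for some `λ > 0`. -/
def MemOrlicz (f : ℝ≥0 → ℝ≥0∞) (μ : Measure Ω) (x : Ω → ℝ) : Prop :=
  AEMeasurable x μ ∧ ∃ l : ℝ≥0, 0 < l ∧ orliczModular f μ (fun t => (l : ℝ) * x t) < ∞

/-- The Luxemburg norm `‖x‖_f = inf {λ > 0 : I_f(x/λ) ≤ 1}` (with `inf ∅ = ∞`). -/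
noncomputable def luxNorm (f : ℝ≥0 → ℝ≥0∞) (μ : Measure Ω) (x : Ω → ℝ) : ℝ≥0∞ :=
  sInf {c : ℝ≥0∞ | ∃ l : ℝ≥0, 0 < l ∧ c = (l : ℝ≥0∞) ∧
    orliczModular f μ (fun t => x t / (l : ℝ)) ≤ 1}

/-- Membership in the space of pointwise multipliers `M(L^{f₁}, L^f)`:
`y ∈ L⁰` and `x·y ∈ L^f` for every `x ∈ L^{f₁}`. -/
def MemMult (f₁ f : ℝ≥0 → ℝ≥0∞) (μ : Measure Ω) (y : Ω → ℝ) : Prop :=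
  AEMeasurable y μ ∧ ∀ x : Ω → ℝ, MemOrlicz f₁ μ x → MemOrlicz f μ (fun t => x t * y t)

/-- The operator norm of `M(L^{f₁}, L^f)`: `‖y‖_M = sup_{‖x‖_{f₁} ≤ 1} ‖x y‖_f`. -/
noncomputable def multNorm (f₁ f : ℝ≥0 → ℝ≥0∞) (μ : Measure Ω) (y : Ω → ℝ) : ℝ≥0∞ :=
  ⨆ x ∈ {x : Ω → ℝ | MemOrlicz f₁ μ x ∧ luxNorm f₁ μ x ≤ 1},
    luxNorm f μ (fun t => x t * y t)

/-- Lemma 1 (1).  For Young functions `φ, φ₁` and `0 < a ≤ b_{φ₁}`,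
the truncated conjugate `φ ⊖_a φ₁` is itself a Young function: it vanishes at `0`,
is non-decreasing and convex. -/
theorem ominusTrunc_is_young (φ φ₁ : YoungFunction) (a : ℝ≥0)
    (ha : 0 < a) (hab : (a : ℝ≥0∞) ≤ bSup φ₁.toFun) :
    ominusTrunc φ.toFun φ₁.toFun a 0 = 0 ∧
    Monotone (ominusTrunc φ.toFun φ₁.toFun a) ∧
    (∀ s t c d : ℝ≥0, c + d = 1 →
      ominusTrunc φ.toFun φ₁.toFun a (c * s + d * t)
        ≤ (c : ℝ≥0∞) * ominusTrunc φ.toFun φ₁.toFun a s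
          + (d : ℝ≥0∞) * ominusTrunc φ.toFun φ₁.toFun a t) := by
  refine ⟨?_, ?_, ?_⟩
  · simp [ominusTrunc, φ.map_zero']
  · intro u v huv
    unfold ominusTrunc
    exact iSup₂_mono fun r _ => tsub_le_tsub_right (φ.mono' (mul_le_mul_right huv r)) _
  · intro s t c d hcd
    have hcd' : (c : ℝ≥0∞) + (d : ℝ≥0∞) = 1 := by exact_mod_cast hcd
    have key : ∀ r ∈ Set.Icc (0 : ℝ≥0) a, ∀ u : ℝ≥0,
        φ.toFun (r * u) ≤ ominusTrunc φ.toFun φ₁.toFun a u + φ₁.toFun r := by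
      intro r hr u
      rw [← tsub_le_iff_right]
      exact le_iSup₂ (f := fun r (_ : r ∈ Set.Icc (0 : ℝ≥0) a) =>
        φ.toFun (r * u) - φ₁.toFun r) r hr
    refine iSup₂_le fun r hr => ?_
    rw [tsub_le_iff_right]
    calc φ.toFun (r * (c * s + d * t))
        = φ.toFun (c * (r * s) + d * (r * t)) := by congr 1; ring
      _ ≤ (c : ℝ≥0∞) * φ.toFun (r * s) + (d : ℝ≥0∞) * φ.toFun (r * t) :=
          φ.convex' _ _ _ _ hcd
      _ ≤ (c : ℝ≥0∞) * (ominusTrunc φ.toFun φ₁.toFun a s + φ₁.toFun r)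
          + (d : ℝ≥0∞) * (ominusTrunc φ.toFun φ₁.toFun a t + φ₁.toFun r) := by
          gcongr
          · exact key r hr s
          · exact key r hr t
      _ = (c : ℝ≥0∞) * ominusTrunc φ.toFun φ₁.toFun a s
          + (d : ℝ≥0∞) * ominusTrunc φ.toFun φ₁.toFun a t
          + ((c : ℝ≥0∞) + (d : ℝ≥0∞)) * φ₁.toFun r := by ring
      _ = _ := by rw [hcd', one_mul]
end

section
/- Let (Ω,Σ,μ) be a σ-finite, complete measure space and φ, φ₁ Young functions. Then L^{φ⊖φ₁} embeds into the multiplier space M(L^{φ₁},L^{φ}): for every y ∈ L^{φ⊖φ₁} and every x ∈ L^{φ₁}, the product xy belongs to L^{φ}, and ‖y‖_{M(L^{φ₁},L^{φ})} ≤ 4‖y‖_{φ⊖φ₁}. -/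
open MeasureTheory ENNReal NNReal Filter Topology

variable {Ω : Type*} [MeasurableSpace Ω]

theorem modular_mul_le (μ : Measure Ω) (φ φ₁ : YoungFunction) (x y : Ω → ℝ)
    (hx : AEMeasurable x μ) :
    orliczModular φ.toFun μ (fun t => x t * y t) ≤
      orliczModular φ₁.toFun μ x + orliczModular (ominus φ.toFun φ₁.toFun) μ y := by
  unfold orliczModular
  have hm : AEMeasurable (fun t => φ₁.toFun ‖x t‖₊) μ :=
    φ₁.mono'.measurable.comp_aemeasurable hx.nnnorm
  rw [← lintegral_add_left' hm]
  refine lintegral_mono fun t => ?_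
  rw [nnnorm_mul, add_comm]
  refine le_tsub_add.trans (add_le_add_left ?_ _)
  exact le_iSup (fun s : ℝ≥0 => φ.toFun (s * ‖y t‖₊) - φ₁.toFun s) ‖x t‖₊

theorem modular_half_le (μ : Measure Ω) (φ : YoungFunction) (x : Ω → ℝ)
    (h : orliczModular φ.toFun μ x ≤ 2) :
    orliczModular φ.toFun μ (fun t => x t / 2) ≤ 1 := by
  have key : ∀ u : ℝ≥0, φ.toFun (u / 2) ≤ ((2⁻¹ : ℝ≥0) : ℝ≥0∞) * φ.toFun u := by
    intro u
    have := φ.convex' u 0 2⁻¹ 2⁻¹ (by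
      apply NNReal.eq; push_cast; norm_num)
    rw [φ.map_zero', mul_zero, mul_zero, add_zero, add_zero] at this
    rwa [div_eq_mul_inv, mul_comm]
  calc orliczModular φ.toFun μ (fun t => x t / 2)
      ≤ ∫⁻ t, ((2⁻¹ : ℝ≥0) : ℝ≥0∞) * φ.toFun ‖x t‖₊ ∂μ := by
        refine lintegral_mono fun t => ?_
        have h2 : ‖x t / 2‖₊ = ‖x t‖₊ / 2 := by simp [nnnorm_div]
        simp only [h2]
        exact key _
    _ = ((2⁻¹ : ℝ≥0) : ℝ≥0∞) * orliczModular φ.toFun μ x :=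
        lintegral_const_mul' _ _ ENNReal.coe_ne_top
    _ ≤ ((2⁻¹ : ℝ≥0) : ℝ≥0∞) * 2 := by gcongr
    _ = 1 := by
        rw [ENNReal.coe_inv (by norm_num)]
        exact ENNReal.inv_mul_cancel (by norm_num) (by norm_num)

/-- embedding (2) of the paper.  `L^{φ⊖φ₁}` embeds into
`M(L^{φ₁}, L^φ)`: for `y ∈ L^{φ⊖φ₁}` and `x ∈ L^{φ₁}` one has `x·y ∈ L^φ`, and
`‖y‖_M ≤ 4 ‖y‖_{φ⊖φ₁}`. -/
theorem orlicz_ominus_subset_multipliers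
    (μ : Measure Ω) [SigmaFinite μ] (hcomp : μ.IsComplete)
    (φ φ₁ : YoungFunction) :
    ∀ y : Ω → ℝ, MemOrlicz (ominus φ.toFun φ₁.toFun) μ y →
      (∀ x : Ω → ℝ, MemOrlicz φ₁.toFun μ x → MemOrlicz φ.toFun μ (fun t => x t * y t)) ∧
      multNorm φ₁.toFun φ.toFun μ y ≤ 4 * luxNorm (ominus φ.toFun φ₁.toFun) μ y := by
  intro y hy
  refine ⟨?_, ?_⟩
  · rintro x ⟨hx, l, hl, hlx⟩
    obtain ⟨hym, k, hk, hky⟩ := hy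
    refine ⟨hx.mul hym, l * k, mul_pos hl hk, ?_⟩
    have := modular_mul_le μ φ φ₁ (fun t => (l : ℝ) * x t) (fun t => (k : ℝ) * y t)
      (hx.const_mul _)
    have he : (fun t => ((l * k : ℝ≥0) : ℝ) * (x t * y t)) =
        fun t => ((l : ℝ) * x t) * ((k : ℝ) * y t) := by
      funext t; push_cast; ring
    rw [he]
    exact this.trans_lt (ENNReal.add_lt_top.2 ⟨hlx, hky⟩)
  · unfold multNorm
    refine iSup₂_le ?_
    rintro x ⟨⟨hx, -⟩, hx1⟩
    have h2 : luxNorm φ₁.toFun μ x < 2 := hx1.trans_lt (by norm_num)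
    obtain ⟨_, ⟨l, hl, rfl, hlx⟩, hl2⟩ := sInf_lt_iff.1 h2
    rw [mul_comm, ← ENNReal.div_le_iff (by norm_num) (by norm_num)]
    refine le_sInf ?_
    rintro _ ⟨k, hk, rfl, hky⟩
    rw [ENNReal.div_le_iff (by norm_num) (by norm_num)]
    have h1 := modular_mul_le μ φ φ₁ (fun t => x t / (l : ℝ)) (fun t => y t / (k : ℝ))
      (hx.div_const _)
    have h3 := modular_half_le μ φ _ (h1.trans ((add_le_add hlx hky).trans_eq one_add_one_eq_two))
    have h4 : luxNorm φ.toFun μ (fun t => x t * y t) ≤ ((l * k * 2 : ℝ≥0) : ℝ≥0∞) := by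
      refine sInf_le ⟨l * k * 2, by positivity, rfl, ?_⟩
      convert h3 using 3 with t
      push_cast
      field_simp
    refine h4.trans ?_
    have hl2' : l ≤ 2 := by exact_mod_cast hl2.le
    have : l * k * 2 ≤ k * 4 := by
      calc l * k * 2 ≤ 2 * k * 2 := by gcongr
        _ = k * 4 := by ring
    exact_mod_cast this
end
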